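/- Let N ≥ 1 be an integer and s ∈ ℝ. Let I ⊆ ℝ be an open interval with 0 ∉ I on which none of the four functions x ↦ U_N(x, s), x ↦ U_{N−1}(x, s), x ↦ U_N(x, s−1), x ↦ U_{N−1}(x, s−1) has a zero, and define v : I → ℝ by v(x) = U_N(x, s−1)·U_{N−1}(x, s) / (U_N(x, s)·U_{N−1}(x, s−1)). Then v satisfies the Painlevé III equation with parameters α = 4(s + N), β = 4(−s + N), γ = 4, δ = −4: for every x ∈ I, v''(x) = v'(x)²/v(x) − v'(x)/x + (α·v(x)² + β)/x + 4·v(x)³ − 4/v(x). -/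

import Mathlib

open Matrix

/-- The Umemura polynomial `U_N(x, σ)` as a Jacobi--Trudi type determinant:
`det (p (N - 2i + j) x σ)_{0 ≤ i,j ≤ N-1}`, with `U_0 = 1` as the empty determinant. -/
noncomputable def umemuraU (p : ℤ → ℝ → ℝ → ℝ) (N : ℕ) (x σ : ℝ) : ℝ :=
  Matrix.det (Matrix.of fun i j : Fin N =>
    p ((N : ℤ) - 2 * ((i : ℕ) : ℤ) + ((j : ℕ) : ℤ)) x σ)


/-- Plücker relation for determinants that share all rows but the first two. -/
lemma det_cons_cons_plucker {R : Type*} [CommRing R] {m : ℕ} (P : Fin m → Fin (m + 2) → R)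
    (a b c d : Fin (m + 2) → R) :
    det (of (vecCons a (vecCons b P))) * det (of (vecCons c (vecCons d P)))
      = det (of (vecCons c (vecCons b P))) * det (of (vecCons a (vecCons d P)))
        + det (of (vecCons a (vecCons c P))) * det (of (vecCons b (vecCons d P))) := by
  set M : Matrix (Fin (m + 2)) (Fin (m + 2)) R := of (vecCons a (vecCons b P)) with hM
  set D : Matrix (Fin (m + 2)) (Fin (m + 2)) R := of (vecCons c (vecCons d P)) with hD
  have hup : ∀ x : Fin (m + 2) → R, D.updateRow 0 x = of (vecCons x (vecCons d P)) := by
    intro x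
    ext i j
    refine Fin.cases ?_ (fun i => ?_) i <;> simp [D, updateRow_apply]
  have hcr : c = fun l => D 0 l := by ext l; simp [D]
  have key := mulVec_cramer Mᵀ c
  have hsum : M.det • c = ∑ j, (Mᵀ.cramer c j) • M j := by
    rw [det_transpose] at key
    rw [← key]
    ext l
    simp [mulVec, dotProduct, Finset.sum_apply, mul_comm]
  have h1 : M.det * D.det = ∑ j, Mᵀ.cramer c j * (D.updateRow 0 (M j)).det := by
    have h2 : (D.updateRow 0 (M.det • c)).det = M.det * D.det := by
      rw [det_updateRow_smul, hup]
    rw [← h2, hsum, ← cramer_transpose_apply, map_sum, Finset.sum_apply]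
    refine Finset.sum_congr rfl fun j _ => ?_
    rw [map_smul, Pi.smul_apply, cramer_transpose_apply, cramer_transpose_apply, smul_eq_mul]
  rw [h1, Fin.sum_univ_succ, Fin.sum_univ_succ, Finset.sum_eq_zero, add_zero,
    cramer_transpose_apply, cramer_transpose_apply, hup, hup]
  · have e0 : M.updateRow 0 c = of (vecCons c (vecCons b P)) := by
      ext i j
      refine Fin.cases ?_ (fun i => ?_) i <;> simp [M, updateRow_apply]
    have e1 : M.updateRow (Fin.succ 0) c = of (vecCons a (vecCons c P)) := by
      ext i j
      refine Fin.cases ?_ (fun i => Fin.cases ?_ (fun i => ?_) i) i <;>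
        simp [M, updateRow_apply, Fin.ext_iff]
    rw [e0, e1]
    rfl
  · intro j _
    rw [hup]
    have : det (of (vecCons (M j.succ.succ) (vecCons d P))) = 0 := by
      refine det_zero_of_row_eq (i := 0) (j := j.succ.succ) (by simp [Fin.ext_iff]) ?_
      ext l
      simp [M]
    rw [this, mul_zero]

lemma det_cons_add {R : Type*} [CommRing R] {m : ℕ} (P : Fin m → Fin (m + 1) → R)
    (a b : Fin (m + 1) → R) (t : R) :
    det (of (vecCons (a + t • b) P)) = det (of (vecCons a P)) + t * det (of (vecCons b P)) := by
  have hup : ∀ x : Fin (m + 1) → R,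
      (of (vecCons a P) : Matrix _ _ R).updateRow 0 x = of (vecCons x P) := by
    intro x
    ext i j
    refine Fin.cases ?_ (fun i => ?_) i <;> simp [updateRow_apply]
  rw [← hup, ← hup b, det_updateRow_add, det_updateRow_smul, hup a]

lemma det_cons_single {R : Type*} [CommRing R] {n : ℕ} (k : Fin (n + 1))
    (P : Fin n → Fin (n + 1) → R) :
    det (of (vecCons (Pi.single k 1) P))
      = (-1) ^ (k : ℕ) * det (of fun i j => P i (k.succAbove j)) := by
  rw [det_succ_row_zero, Finset.sum_eq_single k]
  · simp
    rfl
  · intro b _ hb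
    simp [hb]
  · simp

lemma det_cons_cons_swap {R : Type*} [CommRing R] {m : ℕ} (P : Fin m → Fin (m + 2) → R)
    (a b : Fin (m + 2) → R) :
    det (of (vecCons a (vecCons b P))) = -det (of (vecCons b (vecCons a P))) := by
  have h := det_permute (Equiv.swap (0 : Fin (m + 2)) 1) (of (vecCons a (vecCons b P)))
  rw [Equiv.Perm.sign_swap (by simp)] at h
  have e : (of (vecCons a (vecCons b P))).submatrix (Equiv.swap (0 : Fin (m + 2)) 1) id
      = of (vecCons b (vecCons a P)) := by
    ext i j
    refine Fin.cases ?_ (fun i => Fin.cases ?_ (fun i => ?_) i) i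
    · simp
    · simp
    · rw [submatrix_apply, Equiv.swap_apply_of_ne_of_ne (by simp [Fin.ext_iff])
        (by simp [Fin.ext_iff])]
      simp
  rw [e] at h
  rw [h]
  simp

lemma det_eq_mul_of_last_row {R : Type*} [CommRing R] {n : ℕ}
    (M : Matrix (Fin (n + 1)) (Fin (n + 1)) R)
    (h : ∀ j : Fin n, M (Fin.last n) j.castSucc = 0) :
    M.det = M (Fin.last n) (Fin.last n)
      * det (of fun i j : Fin n => M i.castSucc j.castSucc) := by
  rw [det_succ_row M (Fin.last n), Fin.sum_univ_castSucc, Finset.sum_eq_zero]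
  · rw [zero_add]
    simp only [Fin.val_last, Fin.succAbove_last, ← two_mul, pow_mul]
    simp
    rfl
  · intro j _
    simp [h]

lemma sum_det_updateRow_eq_sum_det_updateCol {R n : Type*} [CommRing R] [Fintype n]
    [DecidableEq n] (M T : Matrix n n R) :
    ∑ i, (M.updateRow i (T i)).det = ∑ j, (M.updateCol j (fun i => T i j)).det := by
  simp only [← cramer_transpose_apply, ← cramer_apply, cramer_eq_adjugate_mulVec, mulVec,
    dotProduct, ← adjugate_transpose, transpose_apply]
  exact Finset.sum_comm

lemma hasDerivAt_det {n : Type*} [Fintype n] [DecidableEq n] {A : ℝ → Matrix n n ℝ}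
    {A' : Matrix n n ℝ} {x : ℝ} (h : ∀ i j, HasDerivAt (fun y => A y i j) (A' i j) x) :
    HasDerivAt (fun y => (A y).det) (∑ i, ((A x).updateRow i (A' i)).det) x := by
  let f : ContinuousMultilinearMap ℝ (fun _ : n => n → ℝ) ℝ :=
    { (detRowAlternating (n := n) (R := ℝ)).toMultilinearMap with
      cont := (continuous_id (X := Matrix n n ℝ)).matrix_det }
  have hg : ∀ i, HasFDerivAt (fun y => A y i)
      (ContinuousLinearMap.toSpanSingleton ℝ (A' i)) x := by
    intro i
    have : HasDerivAt (fun y => A y i) (A' i) x := hasDerivAt_pi.2 (h i)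
    exact this.hasFDerivAt
  have key := (HasFDerivAt.multilinear_comp (f := f) hg).hasDerivAt
  refine key.congr_deriv ?_
  rw [_root_.sum_apply]
  refine Finset.sum_congr rfl fun i _ => ?_
  rw [ContinuousLinearMap.comp_apply, ContinuousLinearMap.toSpanSingleton_apply, one_smul]
  rfl

section Staircase

variable {R : Type*} [CommRing R]

/-- The vector `(c k, c (k - 2), c (k - 4), …)` of length `n`. -/
def stairVec (c : ℤ → R) (n : ℕ) (k : ℤ) : Fin n → R := fun i => c (k - 2 * (i : ℕ))

/-- The staircase determinant of the sequence `c`. -/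
def stairDet (c : ℤ → R) (n : ℕ) : R :=
  det (of fun i j : Fin n => c ((n : ℤ) - 2 * ((i : ℕ) : ℤ) + ((j : ℕ) : ℤ)))

/-- The staircase determinant with the indices in its first column lowered by one. -/
def stairLow (c : ℤ → R) (n : ℕ) : R :=
  det (of fun i j : Fin n =>
    c ((n : ℤ) - 2 * ((i : ℕ) : ℤ) + if (j : ℕ) = 0 then -1 else ((j : ℕ) : ℤ)))

/-- The staircase determinant with the indices in its first row raised by two. -/
def stairRaise (c : ℤ → R) (n : ℕ) : R :=
  det (of fun i j : Fin n =>
    c ((n : ℤ) - (if (i : ℕ) = 0 then -2 else 2 * ((i : ℕ) : ℤ)) + ((j : ℕ) : ℤ)))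

lemma det_stairVec_eq_stairDet (c : ℤ → R) (n : ℕ) :
    det (of (vecCons (stairVec c (n + 1) (n + 1))
      fun j : Fin n => stairVec c (n + 1) (n + 2 + (j : ℕ)))) = stairDet c (n + 1) := by
  rw [stairDet, ← det_transpose]
  congr 1
  ext i j
  refine Fin.cases ?_ (fun j => ?_) j
  · simp [stairVec]
  · simp only [transpose_apply, of_apply, cons_val_succ, stairVec, Fin.val_succ]
    congr 1
    push_cast
    ring

lemma det_stairVec_eq_stairLow (c : ℤ → R) (n : ℕ) :
    det (of (vecCons (stairVec c (n + 1) n)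
      fun j : Fin n => stairVec c (n + 1) (n + 2 + (j : ℕ)))) = stairLow c (n + 1) := by
  rw [stairLow, ← det_transpose]
  congr 1
  ext i j
  refine Fin.cases ?_ (fun j => ?_) j <;> simp [stairVec] <;> congr 1 <;> ring

lemma det_single_zero_eq_stairDet (c : ℤ → R) (n : ℕ) :
    det (of (vecCons (Pi.single 0 1)
      fun j : Fin n => stairVec c (n + 1) (n + 2 + (j : ℕ)))) = stairDet c n := by
  rw [det_cons_single, stairDet, ← det_transpose]
  simp only [Fin.val_zero, pow_zero, one_mul]
  congr 1
  ext i j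
  simp [stairVec]
  congr 1
  ring

lemma det_single_one_eq_stairRaise (c : ℤ → R) (n : ℕ) :
    det (of (vecCons (Pi.single 1 1)
      fun j : Fin (n + 1) => stairVec c (n + 2) (n + 3 + (j : ℕ)))) = -stairRaise c (n + 1) := by
  rw [det_cons_single, stairRaise, ← det_transpose]
  simp only [Fin.val_one, pow_one, neg_one_mul]
  congr 2
  ext i j
  refine Fin.cases ?_ (fun i => ?_) i
  · simp [stairVec]
    congr 1
  · have : (Fin.succAbove 1 i.succ : Fin (n + 2)) = i.succ.succ := by
      rw [Fin.succAbove_of_le_castSucc]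
      simp [Fin.le_def]
    simp [stairVec, this]
    congr 1
    ring

lemma det_cons_stairVec_eq {p q : ℤ → R} {ε : R} (h : ∀ k, p k = q k + ε * q (k - 1)) {m : ℕ}
    (x : Fin (m + 2) → R) (k : ℤ) :
    det (of (vecCons x (vecCons (stairVec q (m + 2) k)
        fun j : Fin m => stairVec p (m + 2) (k + 1 + (j : ℕ)))))
      = det (of (vecCons x fun j : Fin (m + 1) => stairVec q (m + 2) (k + (j : ℕ)))) := by
  symm
  refine det_eq_of_forall_row_eq_smul_add_pred (Fin.cons 0 fun _ => -ε) ?_ ?_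
  · intro j
    simp
  · intro i j
    refine Fin.cases ?_ (fun i => ?_) i
    · simp
    · simp only [Fin.cons_succ, of_apply, cons_val_succ, Fin.castSucc_succ, stairVec, h,
        Fin.val_succ, Fin.val_castSucc]
      have : k + 1 + ((i : ℕ) : ℤ) - 2 * ((j : ℕ) : ℤ) - 1 = k + (i : ℕ) - 2 * (j : ℕ) := by ring
      rw [this]
      have : k + (((i : ℕ) + 1 : ℕ) : ℤ) - 2 * ((j : ℕ) : ℤ)
        = k + 1 + (i : ℕ) - 2 * (j : ℕ) := by push_cast; ring
      rw [this]
      ring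

lemma det_single_zero_cons_eq_stairLow (c : ℤ → R) (m : ℕ) :
    det (of (vecCons (Pi.single 0 1) (vecCons (stairVec c (m + 2) (m + 2))
      fun j : Fin m => stairVec c (m + 2) (m + 4 + (j : ℕ))))) = stairLow c (m + 1) := by
  rw [det_cons_single, stairLow, ← det_transpose]
  simp only [Fin.val_zero, pow_zero, one_mul]
  congr 1
  ext i j
  refine Fin.cases ?_ (fun j => ?_) j <;> simp [stairVec] <;> congr 1 <;> ring

lemma det_single_zero_single_one_eq_stairDet (c : ℤ → R) (m : ℕ) :
    det (of (vecCons (Pi.single 0 1) (vecCons (Pi.single 1 1)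
      fun j : Fin m => stairVec c (m + 2) (m + 4 + (j : ℕ))))) = stairDet c m := by
  rw [det_cons_single]
  have : (of fun (i : Fin (m + 1)) (j : Fin (m + 1)) =>
      (vecCons (Pi.single 1 1) fun j : Fin m => stairVec c (m + 2) (m + 4 + (j : ℕ)) :
        Fin (m + 1) → Fin (m + 2) → R) i (Fin.succAbove 0 j))
      = of (vecCons (Pi.single 0 1) fun j : Fin m => stairVec c (m + 1) (m + 2 + (j : ℕ))) := by
    ext i j
    refine Fin.cases ?_ (fun i => ?_) i
    · refine Fin.cases ?_ (fun j => ?_) j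
      · simp
      · change (Pi.single 1 1 : Fin (m + 2) → R) j.succ.succ
          = (Pi.single 0 1 : Fin (m + 1) → R) j.succ
        rw [Pi.single_eq_of_ne (by simp [Fin.ext_iff]), Pi.single_eq_of_ne (by simp [Fin.ext_iff])]
    · simp only [of_apply, cons_val_succ, stairVec, Fin.zero_succAbove, Fin.val_succ]
      congr 1
      push_cast
      ring
  rw [this, det_single_zero_eq_stairDet]
  simp

lemma det_cons_stairVec_bracket {p q : ℤ → R} {ε : R} (h : ∀ k, p k = q k + ε * q (k - 1))
    (m : ℕ) :
    let w : (Fin (m + 2) → R) → R := fun x =>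
      det (of (vecCons x (vecCons (stairVec q (m + 2) (m + 3))
        fun j : Fin m => stairVec p (m + 2) (m + 4 + (j : ℕ)))))
    w (stairVec q (m + 2) (m + 2)) = stairDet q (m + 2) ∧
    w (stairVec q (m + 2) (m + 1)) = stairLow q (m + 2) ∧
    w (Pi.single 0 1) = stairDet q (m + 1) ∧
    w (Pi.single 1 1) = -stairRaise q (m + 1) := by
  intro w
  have hw : ∀ x, w x
      = det (of (vecCons x fun j : Fin (m + 1) => stairVec q (m + 2) (m + 3 + (j : ℕ)))) := by
    intro x
    rw [← det_cons_stairVec_eq h]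
    simp only [w]
    have : ∀ j : Fin m, (m : ℤ) + 4 + ((j : ℕ) : ℤ) = m + 3 + 1 + (j : ℕ) := fun j => by ring
    simp only [this]
  simp only [hw]
  have e3 : ∀ j : ℕ, ((m + 1 : ℕ) : ℤ) + 2 + j = m + 3 + j := fun j => by push_cast; ring
  have e2 : ((m + 1 : ℕ) : ℤ) + 1 = m + 2 := by push_cast; ring
  have e1 : ((m + 1 : ℕ) : ℤ) = m + 1 := by push_cast; ring
  have e4 : (m : ℤ) + 1 + 2 = m + 3 := by ring
  refine ⟨?_, ?_, ?_, ?_⟩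
  · rw [← det_stairVec_eq_stairDet]
    simp only [e3, e2]
  · rw [← det_stairVec_eq_stairLow]
    simp only [e1, e4]
  · rw [← det_single_zero_eq_stairDet]
    simp only [e3]
  · exact det_single_one_eq_stairRaise q m

lemma stairVec_eq_add {p q : ℤ → R} {ε : R} (h : ∀ k, p k = q k + ε * q (k - 1)) (n : ℕ)
    (k : ℤ) : stairVec p n (k + 1) = stairVec q n (k + 1) + ε • stairVec q n k := by
  ext i
  simp only [stairVec, h, Pi.add_apply, Pi.smul_apply, smul_eq_mul]
  congr 3
  ring

/-- Bilinear relation between consecutive staircase determinants of two sequences related by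
`p k = q k + ε * q (k - 1)`. -/
lemma stairDet_low_bilinear {p q : ℤ → R} {ε : R} (h : ∀ k, p k = q k + ε * q (k - 1)) (m : ℕ) :
    (stairDet q (m + 2) + ε * stairLow q (m + 2)) * stairDet p (m + 1)
      = ε * stairDet q (m + 2) * stairLow p (m + 1)
        + stairDet p (m + 2) * stairDet q (m + 1) := by
  obtain ⟨q0, q1, q2, -⟩ := det_cons_stairVec_bracket h m
  have hp : ∀ k, p k = p k + 0 * p (k - 1) := fun k => by ring
  obtain ⟨p0, -, p2, -⟩ := det_cons_stairVec_bracket hp m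
  beta_reduce at q0 q1 q2 p0 p2
  have p4 := det_single_zero_cons_eq_stairLow p m
  set P : Fin m → Fin (m + 2) → R := fun j => stairVec p (m + 2) (m + 4 + (j : ℕ))
  have key := det_cons_cons_plucker P (stairVec p (m + 2) (m + 2)) (stairVec p (m + 2) (m + 3))
    (stairVec q (m + 2) (m + 3)) (Pi.single 0 1)
  have s3 := stairVec_eq_add h (m + 2) (m + 2)
  have s2 := stairVec_eq_add h (m + 2) (m + 1)
  rw [show (m : ℤ) + 2 + 1 = m + 3 by ring] at s3
  rw [show (m : ℤ) + 1 + 1 = m + 2 by ring] at s2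
  have k1 : det (of (vecCons (stairVec q (m + 2) (m + 3)) (vecCons (stairVec p (m + 2) (m + 3)) P)))
      = -(ε * stairDet q (m + 2)) := by
    rw [det_cons_cons_swap, s3, det_cons_add, q0,
      det_zero_of_row_eq (i := 0) (j := 1) (by simp) (by ext; simp), zero_add]
  have k2 : det (of (vecCons (stairVec p (m + 2) (m + 2)) (vecCons (stairVec q (m + 2) (m + 3)) P)))
      = stairDet q (m + 2) + ε * stairLow q (m + 2) := by
    rw [s2, det_cons_add, q0, q1]
  rw [p0, k1, k2, det_cons_cons_swap P _ (Pi.single 0 1), det_cons_cons_swap P _ (Pi.single 0 1),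
    det_cons_cons_swap P _ (Pi.single 0 1), p2, q2, p4] at key
  linear_combination key

/-- Bilinear relation between staircase determinants whose sizes differ by two, for two sequences
related by `p k = q k + ε * q (k - 1)`. -/
lemma stairDet_raise_bilinear {p q : ℤ → R} {ε : R} (h : ∀ k, p k = q k + ε * q (k - 1)) (m : ℕ) :
    ε * stairDet q (m + 2) * stairDet p m
      = stairRaise p (m + 1) * stairDet q (m + 1) - stairDet p (m + 1) * stairRaise q (m + 1) := by
  obtain ⟨q0, -, q2, q3⟩ := det_cons_stairVec_bracket h m
  have hp : ∀ k, p k = p k + 0 * p (k - 1) := fun k => by ring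
  obtain ⟨-, -, p2, p3⟩ := det_cons_stairVec_bracket hp m
  beta_reduce at q0 q2 q3 p2 p3
  have p5 := det_single_zero_single_one_eq_stairDet p m
  set P : Fin m → Fin (m + 2) → R := fun j => stairVec p (m + 2) (m + 4 + (j : ℕ))
  have key := det_cons_cons_plucker P (stairVec q (m + 2) (m + 2)) (stairVec q (m + 2) (m + 3))
    (Pi.single 0 1) (Pi.single 1 1)
  have s3 := stairVec_eq_add h (m + 2) (m + 2)
  rw [show (m : ℤ) + 2 + 1 = m + 3 by ring] at s3
  rw [det_cons_cons_swap, s3, det_cons_add, det_cons_cons_swap, q2] at p2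
  rw [det_cons_cons_swap, s3, det_cons_add, det_cons_cons_swap, q3] at p3
  rw [q0, q2, p5, det_cons_cons_swap P (stairVec q (m + 2) (m + 3)) (Pi.single 1 1), q3] at key
  linear_combination ε * key - stairDet q (m + 1) * p3 - stairRaise q (m + 1) * p2

lemma det_eq_of_forall_row_eq_smul_add_succ {n : ℕ} {A B : Matrix (Fin (n + 1)) (Fin (n + 1)) R}
    (c : Fin n → R) (hlast : ∀ j, A (Fin.last n) j = B (Fin.last n) j)
    (h : ∀ (i : Fin n) j, A i.castSucc j = B i.castSucc j + c i * A i.succ j) :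
    det A = det B := by
  rw [← det_submatrix_equiv_self Fin.revPerm A, ← det_submatrix_equiv_self Fin.revPerm B]
  refine det_eq_of_forall_row_eq_smul_add_pred (fun i => c i.rev) ?_ ?_
  · intro j
    simpa using hlast j.rev
  · intro i j
    simpa [Fin.rev_succ, Fin.rev_castSucc] using h i.rev j.rev

/-- Subtracting from each row of index at least one the row below it. -/
lemma det_cons_sub_two {q r : ℤ → R} (hr : ∀ k, r k = q k - q (k - 2)) {n : ℕ}
    (a : ℤ) (b : Fin (n + 1) → ℤ) (hq : ∀ j, q (a - 2 * (n + 1) + b j) = 0)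
    (x : Fin (n + 1) → R) :
    det (of (vecCons x fun (i : Fin n) j => r (a - 2 * ((i : ℕ) + 1) + b j)))
      = det (of (vecCons x fun (i : Fin n) j => q (a - 2 * ((i : ℕ) + 1) + b j))) := by
  cases n with
  | zero =>
    exact congrArg (fun P : Fin 0 → Fin 1 → R => det (of (vecCons x P))) (Subsingleton.elim _ _)
  | succ n =>
    symm
    refine det_eq_of_forall_row_eq_smul_add_succ (Fin.cons 0 fun _ => 1) ?_ ?_
    · intro j
      rw [← Fin.succ_last]
      simp only [of_apply, cons_val_succ, Fin.val_last, hr]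
      rw [eq_comm, sub_eq_self, ← hq j]
      congr 1
      push_cast
      ring
    · intro i j
      refine Fin.cases ?_ (fun i => ?_) i
      · simp
      · simp only [of_apply, Fin.castSucc_succ, cons_val_succ, Fin.cons_succ, hr, Fin.val_succ,
          Fin.val_castSucc]
        rw [show a - 2 * (((i : ℕ) : ℤ) + 1) + b j - 2
          = a - 2 * ((((i : ℕ) + 1 : ℕ) : ℤ) + 1) + b j by push_cast; ring]
        ring

lemma det_sub_two {q r : ℤ → R} (hr : ∀ k, r k = q k - q (k - 2)) {n : ℕ}
    (a : ℤ) (b : Fin (n + 1) → ℤ) (hq : ∀ j, q (a - 2 * (n + 1) + b j) = 0) :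
    det (of fun i j : Fin (n + 1) => r (a - 2 * ((i : ℕ) : ℤ) + b j))
      = det (of fun i j : Fin (n + 1) => q (a - 2 * ((i : ℕ) : ℤ) + b j)) := by
  symm
  refine det_eq_of_forall_row_eq_smul_add_succ (fun _ => 1) ?_ ?_
  · intro j
    simp only [of_apply, Fin.val_last, hr]
    rw [eq_comm, sub_eq_self, ← hq j]
    congr 1
    ring
  · intro i j
    simp only [of_apply, hr, Fin.val_succ, Fin.val_castSucc]
    rw [show a - 2 * ((i : ℕ) : ℤ) + b j - 2 = a - 2 * (((i : ℕ) + 1 : ℕ) : ℤ) + b j by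
      push_cast; ring]
    ring

lemma stairDet_sub_two {q r : ℤ → R} (hq : ∀ k < 0, q k = 0) (hr : ∀ k, r k = q k - q (k - 2))
    (n : ℕ) : stairDet r n = stairDet q n := by
  cases n with
  | zero => simp [stairDet]
  | succ n =>
    refine det_sub_two hr _ (fun j => ((j : ℕ) : ℤ)) fun j => hq _ ?_
    have := j.isLt
    push_cast
    omega

lemma stairLow_sub_two {q r : ℤ → R} (hq : ∀ k < 0, q k = 0) (hr : ∀ k, r k = q k - q (k - 2))
    (n : ℕ) : stairLow r n = stairLow q n := by
  cases n with
  | zero => simp [stairLow]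
  | succ n =>
    refine det_sub_two hr _ (fun j => if (j : ℕ) = 0 then -1 else ((j : ℕ) : ℤ)) fun j => hq _ ?_
    have := j.isLt
    push_cast
    split_ifs <;> omega

lemma stairRaise_sub_two {q r : ℤ → R} (hq : ∀ k < 0, q k = 0)
    (hr : ∀ k, r k = q k - q (k - 2)) (n : ℕ) :
    stairRaise r (n + 1) = stairRaise q (n + 1) - stairDet q (n + 1) := by
  have hraise : ∀ c : ℤ → R, stairRaise c (n + 1)
      = det (of (vecCons (fun j : Fin (n + 1) => c (n + 3 + (j : ℕ)))
        fun (i : Fin n) j => c ((n + 1 : ℕ) - 2 * ((i : ℕ) + 1) + ((j : ℕ) : ℤ)))) := by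
    intro c
    rw [stairRaise]
    congr 1
    ext i j
    refine Fin.cases ?_ (fun i => ?_) i
    · simp
      congr 1
    · simp
  have hdet : stairDet q (n + 1)
      = det (of (vecCons (fun j : Fin (n + 1) => q (n + 1 + (j : ℕ)))
        fun (i : Fin n) j => q ((n + 1 : ℕ) - 2 * ((i : ℕ) + 1) + ((j : ℕ) : ℤ)))) := by
    rw [stairDet]
    congr 1
    ext i j
    refine Fin.cases ?_ (fun i => ?_) i <;> simp
  have hrow : (fun j : Fin (n + 1) => r (n + 3 + (j : ℕ)))
      = (fun j : Fin (n + 1) => q (n + 3 + (j : ℕ)))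
        + (-1 : R) • fun j : Fin (n + 1) => q (n + 1 + (j : ℕ)) := by
    ext j
    simp only [hr, Pi.add_apply, Pi.smul_apply, smul_eq_mul]
    rw [show (n : ℤ) + 3 + ((j : ℕ) : ℤ) - 2 = n + 1 + (j : ℕ) by ring]
    ring
  rw [hraise r, det_cons_sub_two hr _ (fun j => ((j : ℕ) : ℤ)), hrow, det_cons_add, ← hraise,
    ← hdet]
  · ring
  · intro j
    refine hq _ ?_
    have := j.isLt
    push_cast
    omega

lemma two_mul_sum_fin_val (n : ℕ) : 2 * ∑ i : Fin (n + 1), ((i : ℕ) : R) = n * (n + 1) := by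
  rw [Fin.sum_univ_eq_sum_range (fun i => (i : R)), ← Nat.cast_sum, mul_comm]
  exact_mod_cast congrArg (Nat.cast (R := R)) (by
    rw [Finset.sum_range_id_mul_two, Nat.add_sub_cancel, mul_comm] :
      (∑ i ∈ Finset.range (n + 1), i) * 2 = n * (n + 1))

/-- The staircase matrix of size `n + 1` with the same parity as the one defining
`stairDet c n`. -/
def stairMat (c : ℤ → R) (n : ℕ) : Matrix (Fin (n + 1)) (Fin (n + 1)) R :=
  of fun i j => c ((n : ℤ) - 2 * ((i : ℕ) : ℤ) + ((j : ℕ) : ℤ))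

lemma stairMat_last {c : ℤ → R} (hc : ∀ k < 0, c k = 0) {n : ℕ} (j : Fin n) :
    stairMat c n (Fin.last n) j.castSucc = 0 := by
  refine hc _ ?_
  have := j.isLt
  simp
  omega

lemma det_stairMat {c : ℤ → R} (hc : ∀ k < 0, c k = 0) (hc0 : c 0 = 1) (n : ℕ) :
    (stairMat c n).det = stairDet c n := by
  rw [det_eq_mul_of_last_row _ (stairMat_last hc), stairDet]
  simp [stairMat]
  rw [show (n : ℤ) - 2 * n + n = 0 by ring, hc0, one_mul]

/-- The staircase matrix with its column `j` shifted by `d`. -/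
def stairMatCol (c : ℤ → R) (n : ℕ) (j : Fin (n + 1)) (d : ℤ) :
    Matrix (Fin (n + 1)) (Fin (n + 1)) R :=
  (stairMat c n).updateCol j fun i => c ((n : ℤ) - 2 * ((i : ℕ) : ℤ) + ((j : ℕ) : ℤ) + d)

lemma det_stairMatCol_eq_zero (c : ℤ → R) {n : ℕ} {j k : Fin (n + 1)} (hjk : j ≠ k) {d : ℤ}
    (h : ((j : ℕ) : ℤ) + d = ((k : ℕ) : ℤ)) : (stairMatCol c n j d).det = 0 := by
  refine det_zero_of_column_eq hjk fun i => ?_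
  rw [stairMatCol, updateCol_self, updateCol_ne hjk.symm]
  simp only [stairMat, of_apply, ← h]
  congr 1
  ring

lemma det_stairMatCol_zero (c : ℤ → R) {n : ℕ} (j : Fin (n + 1)) :
    (stairMatCol c n j 0).det = (stairMat c n).det := by
  congr 1
  ext i k
  rw [stairMatCol, updateCol_apply]
  split_ifs with h
  · subst h
    simp [stairMat]
  · rfl

lemma det_stairMatCol_last {c : ℤ → R} (hc : ∀ k < 0, c k = 0) (n : ℕ) (d : ℤ) :
    (stairMatCol c n (Fin.last n) d).det = c d * stairDet c n := by
  rw [det_eq_mul_of_last_row, stairDet]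
  · congr 2
    · rw [stairMatCol, updateCol_self]
      congr 1
      simp
      ring
    · ext i j
      simp only [stairMatCol, of_apply]
      rw [updateCol_ne (Fin.castSucc_lt_last j).ne]
      rfl
  · intro j
    rw [stairMatCol, updateCol_ne (Fin.castSucc_lt_last j).ne, stairMat_last hc]

lemma det_stairMatCol_neg_one {c : ℤ → R} (hc : ∀ k < 0, c k = 0) (hc0 : c 0 = 1) {n : ℕ}
    (hn : n ≠ 0) : (stairMatCol c n 0 (-1)).det = stairLow c n := by
  have hlast : Fin.last n ≠ 0 := by simpa [Fin.ext_iff] using hn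
  rw [det_eq_mul_of_last_row, stairLow]
  · rw [stairMatCol, updateCol_ne hlast]
    have : stairMat c n (Fin.last n) (Fin.last n) = 1 := by
      simp only [stairMat, of_apply, Fin.val_last]
      rw [show (n : ℤ) - 2 * n + n = 0 by ring, hc0]
    rw [this, one_mul]
    congr 1
    ext i j
    simp only [of_apply, updateCol_apply]
    by_cases h : (j : ℕ) = 0
    · have : j.castSucc = 0 := by simpa [Fin.ext_iff] using h
      simp [this, h]
    · have : j.castSucc ≠ 0 := by simpa [Fin.ext_iff] using h
      simp [this, h, stairMat]
  · intro j
    rw [stairMatCol, updateCol_apply]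
    split_ifs with h
    · refine hc _ ?_
      simp
      omega
    · exact stairMat_last hc j

lemma sum_det_stairMatCol_neg_one {c : ℤ → R} (hc : ∀ k < 0, c k = 0) (hc0 : c 0 = 1) {n : ℕ}
    (hn : n ≠ 0) : ∑ j, (stairMatCol c n j (-1)).det = stairLow c n := by
  rw [Fin.sum_univ_succ, Finset.sum_eq_zero, add_zero, det_stairMatCol_neg_one hc hc0 hn]
  intro j _
  refine det_stairMatCol_eq_zero c (k := j.castSucc) ?_ ?_ <;> simp [Fin.ext_iff]

lemma sum_det_stairMatCol_one {c : ℤ → R} (hc : ∀ k < 0, c k = 0) (n : ℕ) :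
    ∑ j, (stairMatCol c n j 1).det = c 1 * stairDet c n := by
  rw [Fin.sum_univ_castSucc, Finset.sum_eq_zero, zero_add, det_stairMatCol_last hc]
  intro j _
  refine det_stairMatCol_eq_zero c (k := j.succ) ?_ ?_ <;> simp [Fin.ext_iff]

lemma sum_det_stairMatCol_two {c : ℤ → R} (hc : ∀ k < 0, c k = 0) (n : ℕ) :
    ∑ j : Fin (n + 1), ((n : R) - 1 - ((j : ℕ) : R)) * (stairMatCol c n j 2).det
      = -(c 2 * stairDet c n) := by
  rw [Fin.sum_univ_castSucc, Finset.sum_eq_zero, zero_add, det_stairMatCol_last hc]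
  · simp
  · intro j _
    by_cases h : (j : ℕ) + 1 = n
    · have : (n : R) - 1 - ((j.castSucc : Fin (n + 1)) : ℕ) = 0 := by
        have h' := congrArg (Nat.cast (R := R)) h
        rw [Fin.val_castSucc]
        push_cast at h'
        linear_combination -h'
      rw [this, zero_mul]
    · have := j.isLt
      rw [det_stairMatCol_eq_zero c (k := ⟨j + 2, by omega⟩), mul_zero]
      · simp [Fin.ext_iff]
      · simp

/-- Replacing a row of `stairMat` by its shift by two gives zero unless the row is the first. -/
lemma sum_det_updateRow_stairMat {c : ℤ → R} (hc : ∀ k < 0, c k = 0) (hc0 : c 0 = 1) {n : ℕ}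
    (hn : n ≠ 0) (w : Fin (n + 1) → R) :
    ∑ i, w i * ((stairMat c n).updateRow i fun j =>
        c ((n : ℤ) - 2 * ((i : ℕ) : ℤ) + ((j : ℕ) : ℤ) + 2)).det
      = w 0 * stairRaise c n := by
  have hlast : Fin.last n ≠ 0 := by simpa [Fin.ext_iff] using hn
  rw [Fin.sum_univ_succ, Finset.sum_eq_zero, add_zero]
  · congr 1
    rw [det_eq_mul_of_last_row, stairRaise]
    · rw [updateRow_ne hlast]
      have : stairMat c n (Fin.last n) (Fin.last n) = 1 := by
        simp only [stairMat, of_apply, Fin.val_last]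
        rw [show (n : ℤ) - 2 * n + n = 0 by ring, hc0]
      rw [this, one_mul]
      congr 1
      ext i j
      simp only [of_apply, updateRow_apply]
      by_cases h : (i : ℕ) = 0
      · have : i.castSucc = 0 := by simpa [Fin.ext_iff] using h
        simp [this, h]
        congr 1
        ring
      · have : i.castSucc ≠ 0 := by simpa [Fin.ext_iff] using h
        simp [this, h, stairMat]
    · intro j
      rw [updateRow_ne hlast, stairMat_last hc]
  · intro i _
    rw [det_zero_of_row_eq (i := i.succ) (j := i.castSucc), mul_zero]
    · simp [Fin.ext_iff]
    · rw [updateRow_self, updateRow_ne (by simp [Fin.ext_iff])]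
      ext j
      simp only [stairMat, of_apply, Fin.val_succ, Fin.val_castSucc]
      congr 1
      push_cast
      ring

/-- Reduction of `stairRaise` to `stairDet` and `stairLow` for sequences satisfying a Laguerre type
recursion. -/
lemma stairRaise_eq {c : ℤ → R} (hc : ∀ k < 0, c k = 0) (hc0 : c 0 = 1) {α β : R}
    (hrec : ∀ k : ℤ, ((k : R) + 2) * c (k + 2) - k * c k
      = α * (c (k + 1) - c k) + β * (c (k + 1) - c (k - 1))) {n : ℕ} (hn : n ≠ 0) :
    2 * ((2 * n + 1) * stairRaise c n)
      = (2 * ((α + β) * c 1 - α * (n + 1) - c 2) + n * (n + 1)) * stairDet c n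
        - 2 * (β * stairLow c n) := by
  have key := sum_det_updateRow_eq_sum_det_updateCol (stairMat c n)
    (of fun i j => ((n : R) - 2 * ((i : ℕ) : R) + n + 1)
        * c ((n : ℤ) - 2 * ((i : ℕ) : ℤ) + ((j : ℕ) : ℤ) + 2)
      - ((n : R) - 2 * ((i : ℕ) : R)) * stairMat c n i j)
  have hrow : ∀ i, ((stairMat c n).updateRow i ((of fun i j : Fin (n + 1) =>
        ((n : R) - 2 * ((i : ℕ) : R) + n + 1)
          * c ((n : ℤ) - 2 * ((i : ℕ) : ℤ) + ((j : ℕ) : ℤ) + 2)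
        - ((n : R) - 2 * ((i : ℕ) : R)) * stairMat c n i j) i)).det
      = ((n : R) - 2 * ((i : ℕ) : R) + n + 1) * ((stairMat c n).updateRow i fun j =>
          c ((n : ℤ) - 2 * ((i : ℕ) : ℤ) + ((j : ℕ) : ℤ) + 2)).det
        - ((n : R) - 2 * ((i : ℕ) : R)) * stairDet c n := by
    intro i
    rw [← det_stairMat hc hc0]
    nth_rw 4 [← updateRow_eq_self (stairMat c n) i]
    rw [← det_updateRow_smul, sub_eq_add_neg, ← neg_mul, ← det_updateRow_smul,
      ← det_updateRow_add]
    congr 2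
    ext j
    simp
    ring
  have hcol : ∀ j, ((stairMat c n).updateCol j fun i => (of fun i j : Fin (n + 1) =>
        ((n : R) - 2 * ((i : ℕ) : R) + n + 1)
          * c ((n : ℤ) - 2 * ((i : ℕ) : ℤ) + ((j : ℕ) : ℤ) + 2)
        - ((n : R) - 2 * ((i : ℕ) : R)) * stairMat c n i j) i j).det
      = (α + β) * (stairMatCol c n j 1).det + (((j : ℕ) : R) - α) * stairDet c n
        + (-β) * (stairMatCol c n j (-1)).det
        + ((n : R) - 1 - ((j : ℕ) : R)) * (stairMatCol c n j 2).det := by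
    intro j
    rw [← det_stairMat hc hc0, ← det_stairMatCol_zero c j]
    simp only [stairMatCol, ← det_updateCol_smul, ← det_updateCol_add]
    congr 2
    ext i
    have h := hrec ((n : ℤ) - 2 * ((i : ℕ) : ℤ) + ((j : ℕ) : ℤ))
    simp only [stairMat, of_apply, Pi.add_apply, Pi.smul_apply, smul_eq_mul, add_zero,
      ← sub_eq_add_neg]
    push_cast at h
    linear_combination h
  simp only [hrow, hcol, Finset.sum_sub_distrib, Finset.sum_add_distrib, ← Finset.mul_sum,
    ← Finset.sum_mul] at key
  rw [sum_det_updateRow_stairMat hc hc0 hn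
    (fun i => (n : R) - 2 * ((i : ℕ) : R) + n + 1), sum_det_stairMatCol_one hc,
    sum_det_stairMatCol_neg_one hc hc0 hn, sum_det_stairMatCol_two hc] at key
  have hs := two_mul_sum_fin_val (R := R) n
  simp only [Finset.sum_const, Finset.card_univ, Fintype.card_fin, nsmul_eq_mul, Fin.val_zero,
    Nat.cast_zero] at key
  push_cast at key
  linear_combination 2 * key - hs * stairDet c n
end Staircase

lemma hasDerivAt_stairDet {c : ℝ → ℤ → ℝ} {x : ℝ}
    (h : ∀ k, HasDerivAt (fun y => c y k) (2 * c x (k - 1)) x) (n : ℕ) :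
    HasDerivAt (fun y => stairDet (c y) (n + 1)) (2 * stairLow (c x) (n + 1)) x := by
  have hdet : ∀ y, stairDet (c y) (n + 1) = det (of fun i j : Fin (n + 1) =>
      c y ((n + 1 : ℕ) - 2 * ((j : ℕ) : ℤ) + ((i : ℕ) : ℤ))) := fun y => by
    rw [stairDet, ← det_transpose]
    rfl
  simp only [hdet]
  refine (hasDerivAt_det (A := fun y => of fun i j : Fin (n + 1) =>
    c y ((n + 1 : ℕ) - 2 * ((j : ℕ) : ℤ) + ((i : ℕ) : ℤ))) (A' := of fun i j : Fin (n + 1) =>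
    2 * c x ((n + 1 : ℕ) - 2 * ((j : ℕ) : ℤ) + ((i : ℕ) : ℤ) - 1)) fun i j => h _).congr_deriv ?_
  rw [Fin.sum_univ_succ, Finset.sum_eq_zero, add_zero]
  · have : (of fun i j : Fin (n + 1) =>
        2 * c x ((n + 1 : ℕ) - 2 * ((j : ℕ) : ℤ) + ((i : ℕ) : ℤ) - 1)) 0
        = (2 : ℝ) • fun j : Fin (n + 1) => c x ((n + 1 : ℕ) - 2 * ((j : ℕ) : ℤ) - 1) := by
      ext j
      simp
    rw [this, det_updateRow_smul, stairLow, ← det_transpose]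
    congr 2
    ext i j
    simp only [transpose_apply, updateRow_apply, of_apply]
    by_cases hj : j = 0
    · simp [hj, ← sub_eq_add_neg]
    · simp [hj]
  · intro i _
    have : (of fun i j : Fin (n + 1) =>
        2 * c x ((n + 1 : ℕ) - 2 * ((j : ℕ) : ℤ) + ((i : ℕ) : ℤ) - 1)) i.succ
        = (2 : ℝ) • fun j : Fin (n + 1) =>
          c x ((n + 1 : ℕ) - 2 * ((j : ℕ) : ℤ) + ((i : ℕ) : ℤ)) := by
      ext j
      simp only [of_apply, Pi.smul_apply, smul_eq_mul, Fin.val_succ]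
      congr 2
      push_cast
      ring
    rw [this, det_updateRow_smul, det_zero_of_row_eq (i := i.succ) (j := i.castSucc), mul_zero]
    · simp [Fin.ext_iff]
    · rw [updateRow_self, updateRow_ne (by simp [Fin.ext_iff])]
      rfl

/-- The three-term recursion of the polynomials with generating function
`(1 + λ) ^ (σ + 1 / 2) * exp (2 * x * λ)`, over all integer indices. -/
structure IsLaguerreSeq (p : ℤ → ℝ → ℝ → ℝ) : Prop where
  eq_zero : ∀ k < 0, ∀ x σ, p k x σ = 0
  zero : ∀ x σ, p 0 x σ = 1
  mul_eq : ∀ (k : ℤ) (x σ : ℝ),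
    (k : ℝ) * p k x σ = (2 * x + σ + 3 / 2 - k) * p (k - 1) x σ + 2 * x * p (k - 2) x σ

namespace IsLaguerreSeq

variable {p : ℤ → ℝ → ℝ → ℝ}

lemma one (hp : IsLaguerreSeq p) (x σ : ℝ) : p 1 x σ = 2 * x + σ + 1 / 2 := by
  have h := hp.mul_eq 1 x σ
  rw [show (1 : ℤ) - 1 = 0 by ring, hp.zero, hp.eq_zero (1 - 2) (by norm_num)] at h
  push_cast at h
  linear_combination h

lemma two_mul_two (hp : IsLaguerreSeq p) (x σ : ℝ) :
    2 * p 2 x σ = (2 * x + σ - 1 / 2) * (2 * x + σ + 1 / 2) + 2 * x := by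
  have h := hp.mul_eq 2 x σ
  rw [show (2 : ℤ) - 1 = 1 by ring, sub_self, hp.zero, hp.one] at h
  push_cast at h
  linear_combination h

lemma induction_on {P : ℤ → Prop} (neg : ∀ k < 0, P k) (zero : P 0)
    (step : ∀ k > 0, P (k - 1) → P (k - 2) → P k) (k : ℤ) : P k := by
  have key : ∀ (n : ℕ) (k : ℤ), k ≤ n → P k := by
    intro n
    induction n with
    | zero =>
      intro k hk
      rcases lt_or_eq_of_le hk with h | h
      · exact neg k h
      · simpa [h] using zero
    | succ n ih =>
      intro k hk
      rcases le_or_gt k n with h | h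
      · exact ih k h
      · push_cast at hk
        exact step k (by omega) (ih _ (by omega)) (ih _ (by omega))
  exact key k.toNat k (Int.self_le_toNat k)

lemma eq_add (hp : IsLaguerreSeq p) (x σ : ℝ) (k : ℤ) :
    p k x σ = p k x (σ - 1) + p (k - 1) x (σ - 1) := by
  refine induction_on (P := fun k => p k x σ = p k x (σ - 1) + p (k - 1) x (σ - 1)) ?_ ?_ ?_ k
  · intro k hk
    simp [hp.eq_zero k hk, hp.eq_zero (k - 1) (by omega)]
  · simp [hp.zero, hp.eq_zero (-1) (by omega)]
  · intro k hk h1 h2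
    have hk' : (k : ℝ) ≠ 0 := by exact_mod_cast hk.ne'
    refine mul_left_cancel₀ hk' ?_
    have e1 := hp.mul_eq k x σ
    have e2 := hp.mul_eq k x (σ - 1)
    have e3 := hp.mul_eq (k - 1) x (σ - 1)
    rw [show k - 1 - 1 = k - 2 by ring] at h1 e3
    rw [show k - 1 - 2 = k - 3 by ring] at e3
    rw [show k - 2 - 1 = k - 3 by ring] at h2
    rw [h1, h2] at e1
    push_cast at e3
    linear_combination e1 - e2 - e3

lemma hasDerivAt (hp : IsLaguerreSeq p) (σ x : ℝ) (k : ℤ) :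
    HasDerivAt (fun y => p k y σ) (2 * p (k - 1) x σ) x := by
  refine induction_on (P := fun k => HasDerivAt (fun y => p k y σ) (2 * p (k - 1) x σ) x)
    ?_ ?_ ?_ k
  · intro k hk
    simp only [hp.eq_zero k hk, hp.eq_zero (k - 1) (by omega), mul_zero]
    exact hasDerivAt_const x 0
  · simp only [hp.zero, hp.eq_zero (0 - 1) (by omega), mul_zero]
    exact hasDerivAt_const x 1
  · intro k hk h1 h2
    have hk' : (k : ℝ) ≠ 0 := by exact_mod_cast hk.ne'
    have heq : (fun y => p k y σ) = fun y =>
        ((2 * y + σ + 3 / 2 - k) * p (k - 1) y σ + 2 * y * p (k - 2) y σ) / k := by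
      ext y
      rw [eq_div_iff hk', mul_comm, hp.mul_eq]
    rw [heq]
    have hl : HasDerivAt (fun y : ℝ => 2 * y) 2 x := by
      simpa using (hasDerivAt_id x).const_mul 2
    have hl' : HasDerivAt (fun y : ℝ => 2 * y + σ + 3 / 2 - k) 2 x :=
      ((hl.add_const σ).add_const (3 / 2)).sub_const (k : ℝ)
    refine (((hl'.mul h1).add (hl.mul h2)).div_const (k : ℝ)).congr_deriv ?_
    have e3 := hp.mul_eq (k - 1) x σ
    rw [show k - 1 - 1 = k - 2 by ring] at e3 ⊢
    rw [show k - 1 - 2 = k - 3 by ring] at e3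
    rw [show k - 2 - 1 = k - 3 by ring, div_eq_iff hk']
    push_cast at e3
    linear_combination -2 * e3

lemma mul_sub_mul (hp : IsLaguerreSeq p) (x σ : ℝ) (k : ℤ) :
    ((k : ℝ) + 2) * p (k + 2) x σ - k * p k x σ
      = (σ + 1 / 2) * (p (k + 1) x σ - p k x σ) + 2 * x * (p (k + 1) x σ - p (k - 1) x σ) := by
  have e1 := hp.mul_eq (k + 2) x σ
  have e2 := hp.mul_eq (k + 1) x σ
  rw [show k + 2 - 1 = k + 1 by ring, show k + 2 - 2 = k by ring] at e1
  rw [show k + 1 - 1 = k by ring, show k + 1 - 2 = k - 1 by ring] at e2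
  push_cast at e1 e2
  linear_combination e1 - e2

lemma eq_add_one_mul (hp : IsLaguerreSeq p) (x σ : ℝ) (k : ℤ) :
    p k x σ = p k x (σ - 1) + 1 * p (k - 1) x (σ - 1) := by
  rw [one_mul, hp.eq_add]

lemma sub_two_eq_add (hp : IsLaguerreSeq p) (x σ : ℝ) (k : ℤ) :
    p k x (σ - 1) - p (k - 2) x (σ - 1) = p k x σ + -1 * p (k - 1) x σ := by
  rw [hp.eq_add x σ k, hp.eq_add x σ (k - 1), show k - 1 - 1 = k - 2 by ring]
  ring

lemma umemuraU_zero (x σ : ℝ) : umemuraU p 0 x σ = 1 := by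
  simp [umemuraU]

lemma umemuraU_one (hp : IsLaguerreSeq p) (x σ : ℝ) : umemuraU p 1 x σ = 2 * x + σ + 1 / 2 := by
  simp [umemuraU, hp.one]

lemma umemuraU_eq (n : ℕ) (x σ : ℝ) : umemuraU p n x σ = stairDet (fun k => p k x σ) n := rfl

lemma hasDerivAt_umemuraU_succ (hp : IsLaguerreSeq p) (n : ℕ) (x σ : ℝ) :
    HasDerivAt (fun y => umemuraU p (n + 1) y σ)
      (2 * stairLow (fun k => p k x σ) (n + 1)) x :=
  hasDerivAt_stairDet (c := fun y k => p k y σ) (hp.hasDerivAt σ x) n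

lemma deriv_umemuraU_succ (hp : IsLaguerreSeq p) (n : ℕ) (x σ : ℝ) :
    deriv (fun y => umemuraU p (n + 1) y σ) x = 2 * stairLow (fun k => p k x σ) (n + 1) :=
  (hp.hasDerivAt_umemuraU_succ n x σ).deriv

lemma hasDerivAt_umemuraU (hp : IsLaguerreSeq p) (n : ℕ) (x σ : ℝ) :
    HasDerivAt (fun y => umemuraU p n y σ) (deriv (fun y => umemuraU p n y σ) x) x := by
  cases n with
  | zero => simpa only [umemuraU_zero, deriv_const] using hasDerivAt_const x (1 : ℝ)
  | succ n => exact (hp.hasDerivAt_umemuraU_succ n x σ).differentiableAt.hasDerivAt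

lemma deriv_umemuraU_zero (x σ : ℝ) : deriv (fun y => umemuraU p 0 y σ) x = 0 := by
  simp only [umemuraU_zero, deriv_const]

lemma deriv_umemuraU_one (hp : IsLaguerreSeq p) (x σ : ℝ) :
    deriv (fun y => umemuraU p 1 y σ) x = 2 := by
  rw [(hp.hasDerivAt_umemuraU_succ 0 x σ).deriv]
  simp [stairLow, hp.zero]

lemma bilinear_lower (hp : IsLaguerreSeq p) (n : ℕ) (x σ : ℝ) :
    deriv (fun y => umemuraU p (n + 1) y (σ - 1)) x * umemuraU p n x σ
      - umemuraU p (n + 1) x (σ - 1) * deriv (fun y => umemuraU p n y σ) x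
      + 2 * umemuraU p (n + 1) x (σ - 1) * umemuraU p n x σ
      = 2 * umemuraU p (n + 1) x σ * umemuraU p n x (σ - 1) := by
  cases n with
  | zero =>
    simp only [zero_add, deriv_umemuraU_zero, hp.deriv_umemuraU_one]
    simp only [umemuraU_zero, hp.umemuraU_one]
    ring
  | succ m =>
    have h := stairDet_low_bilinear (hp.eq_add_one_mul x σ) m
    simp only [hp.deriv_umemuraU_succ]
    simp only [umemuraU_eq]
    linear_combination 2 * h

lemma bilinear_upper (hp : IsLaguerreSeq p) (n : ℕ) (x σ : ℝ) :
    deriv (fun y => umemuraU p (n + 1) y σ) x * umemuraU p n x (σ - 1)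
      - umemuraU p (n + 1) x σ * deriv (fun y => umemuraU p n y (σ - 1)) x
      - 2 * umemuraU p (n + 1) x σ * umemuraU p n x (σ - 1)
      = -2 * umemuraU p (n + 1) x (σ - 1) * umemuraU p n x σ := by
  cases n with
  | zero =>
    simp only [zero_add, deriv_umemuraU_zero, hp.deriv_umemuraU_one]
    simp only [umemuraU_zero, hp.umemuraU_one]
    ring
  | succ m =>
    have h := stairDet_low_bilinear (hp.sub_two_eq_add x σ) m
    rw [stairDet_sub_two (q := fun k => p k x (σ - 1)) (fun k hk => hp.eq_zero k hk x _)
        fun k => rfl,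
      stairDet_sub_two (q := fun k => p k x (σ - 1)) (fun k hk => hp.eq_zero k hk x _)
        fun k => rfl,
      stairLow_sub_two (q := fun k => p k x (σ - 1)) (fun k hk => hp.eq_zero k hk x _)
        fun k => rfl] at h
    simp only [hp.deriv_umemuraU_succ]
    simp only [umemuraU_eq]
    linear_combination -2 * h

lemma bilinear_sizes (hp : IsLaguerreSeq p) (n : ℕ) (x σ : ℝ) :
    umemuraU p (n + 1) x σ * umemuraU p (n - 1) x (σ - 1)
      = umemuraU p (n + 1) x (σ - 1) * umemuraU p (n - 1) x σ
        + umemuraU p n x σ * umemuraU p n x (σ - 1) := by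
  cases n with
  | zero =>
    simp only [zero_add, zero_tsub, umemuraU_zero, hp.umemuraU_one]
    ring
  | succ m =>
    have h1 := stairDet_raise_bilinear (hp.eq_add_one_mul x σ) m
    have h2 := stairDet_raise_bilinear (hp.sub_two_eq_add x σ) m
    simp only [stairDet_sub_two (q := fun k => p k x (σ - 1)) (fun k hk => hp.eq_zero k hk x _)
        fun k => rfl,
      stairRaise_sub_two (q := fun k => p k x (σ - 1)) (fun k hk => hp.eq_zero k hk x _)
        fun k => rfl] at h2
    simp only [umemuraU_eq, Nat.add_sub_cancel]
    linear_combination -h1 - h2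

lemma mul_wronskian_eq (hp : IsLaguerreSeq p) (n : ℕ) (x σ : ℝ) :
    x * (deriv (fun y => umemuraU p n y σ) x * umemuraU p n x (σ - 1)
        - umemuraU p n x σ * deriv (fun y => umemuraU p n y (σ - 1)) x
        - 2 * umemuraU p n x σ * umemuraU p n x (σ - 1))
      = -(2 * n + 1) * umemuraU p (n + 1) x (σ - 1) * umemuraU p (n - 1) x σ
        - (n + 1 / 2 - σ) * umemuraU p n x σ * umemuraU p n x (σ - 1) := by
  cases n with
  | zero =>
    simp only [zero_add, zero_tsub, deriv_umemuraU_zero]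
    simp only [umemuraU_zero, hp.umemuraU_one]
    push_cast
    ring
  | succ m =>
    have h1 := stairDet_raise_bilinear (hp.eq_add_one_mul x σ) m
    have r := fun τ : ℝ => stairRaise_eq (c := fun k => p k x τ)
      (fun k hk => hp.eq_zero k hk x _) (hp.zero x τ) (hp.mul_sub_mul x τ) m.succ_ne_zero
    have r1 := r σ
    have r2 := r (σ - 1)
    have e1 := hp.two_mul_two x σ
    have e2 := hp.two_mul_two x (σ - 1)
    simp only [hp.deriv_umemuraU_succ]
    simp only [umemuraU_eq, Nat.add_sub_cancel]
    simp only [hp.one, Nat.succ_eq_add_one] at r1 r2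
    push_cast at r1 r2 ⊢
    generalize stairRaise (fun k => p k x σ) (m + 1) = A at *
    generalize stairRaise (fun k => p k x (σ - 1)) (m + 1) = B at *
    generalize stairDet (fun k => p k x σ) (m + 1) = F at *
    generalize stairDet (fun k => p k x (σ - 1)) (m + 1) = G at *
    linear_combination (2 * m + 3) * h1 + (1 / 2) * G * r1 - (1 / 2) * F * r2
      - (1 / 2) * F * G * (e1 - e2)

end IsLaguerreSeq

lemma painleve_of_hasDerivAt {S : Set ℝ} (hS : IsOpen S) {n s : ℝ} {v Y : ℝ → ℝ}
    (h0 : ∀ x ∈ S, x ≠ 0) (hv0 : ∀ x ∈ S, v x ≠ 0)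
    (hv : ∀ x ∈ S, HasDerivAt v (2 * v x * Y x / x + 2 + 2 * v x ^ 2) x)
    (hY : ∀ x ∈ S, HasDerivAt Y (2 / v x * (Y x + (n - 1 / 2 - s))
      - 2 * v x * (Y x - (s + n - 1 / 2))) x) :
    ∀ x ∈ S, deriv (deriv v) x
        = (deriv v x) ^ 2 / v x - deriv v x / x
          + (4 * (s + n) * (v x) ^ 2 + 4 * (-s + n)) / x
          + 4 * (v x) ^ 3 - 4 / v x := by
  intro x hx
  have hev : deriv v =ᶠ[nhds x] fun y => 2 * v y * Y y / y + 2 + 2 * v y ^ 2 := by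
    filter_upwards [hS.mem_nhds hx] with y hy using (hv y hy).deriv
  have hd := (((((hv x hx).const_mul 2).mul (hY x hx)).div (hasDerivAt_id x) (h0 x hx)).add_const
    2).add (((hv x hx).pow 2).const_mul 2)
  have hd' : deriv (fun y => 2 * v y * Y y / y + 2 + 2 * v y ^ 2) x = _ := hd.deriv
  rw [hev.deriv_eq, hd', (hv x hx).deriv]
  have hx0 := h0 x hx
  have hvx := hv0 x hx
  simp only [id, Pi.mul_apply]
  field_simp
  ring

lemma painleve_of_bilinear {S : Set ℝ} (hS : IsOpen S) {n s : ℝ}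
    {f g F G F₂ G₂ f' g' F' G' F₂' : ℝ → ℝ} (h0 : ∀ x ∈ S, x ≠ 0)
    (hf0 : ∀ x ∈ S, f x ≠ 0) (hg0 : ∀ x ∈ S, g x ≠ 0)
    (hF0 : ∀ x ∈ S, F x ≠ 0) (hG0 : ∀ x ∈ S, G x ≠ 0)
    (hf : ∀ x, HasDerivAt f (f' x) x) (hg : ∀ x, HasDerivAt g (g' x) x)
    (hF : ∀ x, HasDerivAt F (F' x) x) (hG : ∀ x, HasDerivAt G (G' x) x)
    (hF₂ : ∀ x, HasDerivAt F₂ (F₂' x) x)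
    (hgF : ∀ x, g' x * F x - g x * F' x + 2 * g x * F x = 2 * f x * G x)
    (hfG : ∀ x, f' x * G x - f x * G' x - 2 * f x * G x = -2 * g x * F x)
    (hGF : ∀ x, G' x * F₂ x - G x * F₂' x + 2 * G x * F₂ x = 2 * F x * G₂ x)
    (hFG : ∀ x, x * (F' x * G x - F x * G' x - 2 * F x * G x)
      = -(2 * n - 1) * g x * F₂ x - (n - 1 / 2 - s) * F x * G x)
    (hfg : ∀ x, f x * G₂ x = g x * F₂ x + F x * G x)
    {v : ℝ → ℝ} (hv : ∀ x, v x = g x * F x / (f x * G x)) :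
    ∀ x ∈ S, deriv (deriv v) x
        = (deriv v x) ^ 2 / v x - deriv v x / x
          + (4 * (s + n) * (v x) ^ 2 + 4 * (-s + n)) / x
          + 4 * (v x) ^ 3 - 4 / v x := by
  refine painleve_of_hasDerivAt hS
    (Y := fun x => -(2 * n - 1) * (g x * F₂ x / (F x * G x)) - (n - 1 / 2 - s)) h0 ?_ ?_ ?_
  · intro x hx
    rw [hv]
    exact div_ne_zero (mul_ne_zero (hg0 x hx) (hF0 x hx)) (mul_ne_zero (hf0 x hx) (hG0 x hx))
  · intro x hx
    have hx0 := h0 x hx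
    have hfx := hf0 x hx
    have hgx := hg0 x hx
    have hFx := hF0 x hx
    have hGx := hG0 x hx
    rw [funext hv]
    refine (((hg x).mul (hF x)).div ((hf x).mul (hG x)) (mul_ne_zero hfx hGx)).congr_deriv ?_
    have hY : -(2 * n - 1) * (g x * F₂ x / (F x * G x)) - (n - 1 / 2 - s)
        = x * (F' x * G x - F x * G' x - 2 * F x * G x) / (F x * G x) := by
      rw [hFG]
      field_simp
    simp only [hY, Pi.mul_apply]
    field_simp
    linear_combination f x * G x * hgF x - g x * F x * hfG x
  · intro x hx
    have hfx := hf0 x hx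
    have hgx := hg0 x hx
    have hFx := hF0 x hx
    have hGx := hG0 x hx
    refine (((((hg x).mul (hF₂ x)).div ((hF x).mul (hG x)) (mul_ne_zero hFx hGx)).const_mul
      (-(2 * n - 1))).sub_const (n - 1 / 2 - s)).congr_deriv ?_
    have hY : -(2 * n - 1) * (g x * F₂ x / (F x * G x)) - (n - 1 / 2 - s) - (s + n - 1 / 2)
        = -(2 * n - 1) * (f x * G₂ x / (F x * G x)) := by
      rw [hfg]
      field_simp
      ring
    rw [hY, sub_add_cancel, hv]
    simp only [Pi.mul_apply]
    field_simp
    linear_combination (1 - 2 * n) * (F₂ x * G x * hgF x - g x * F x * hGF x)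

theorem rational_solutions_PIII
    (p : ℤ → ℝ → ℝ → ℝ)
    (hp_neg : ∀ k : ℤ, k < 0 → ∀ x σ : ℝ, p k x σ = 0)
    (hp_zero : ∀ x σ : ℝ, p 0 x σ = 1)
    (hp_rec : ∀ k : ℕ, 1 ≤ k → ∀ x σ : ℝ,
      (k : ℝ) * p (k : ℤ) x σ
        = (2 * x + σ + 3 / 2 - (k : ℝ)) * p ((k : ℤ) - 1) x σ
          + 2 * x * p ((k : ℤ) - 2) x σ)
    (N : ℕ) (hN : 1 ≤ N) (s : ℝ)
    (a b : ℝ) (hab : a < b) (h0 : (0 : ℝ) ∉ Set.Ioo a b)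
    (hU1 : ∀ x ∈ Set.Ioo a b, umemuraU p N x s ≠ 0)
    (hU2 : ∀ x ∈ Set.Ioo a b, umemuraU p (N - 1) x s ≠ 0)
    (hU3 : ∀ x ∈ Set.Ioo a b, umemuraU p N x (s - 1) ≠ 0)
    (hU4 : ∀ x ∈ Set.Ioo a b, umemuraU p (N - 1) x (s - 1) ≠ 0)
    (v : ℝ → ℝ)
    (hv : ∀ x : ℝ, v x = umemuraU p N x (s - 1) * umemuraU p (N - 1) x s
      / (umemuraU p N x s * umemuraU p (N - 1) x (s - 1))) :
    ∀ x ∈ Set.Ioo a b,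
      deriv (deriv v) x
        = (deriv v x) ^ 2 / v x - deriv v x / x
          + (4 * (s + (N : ℝ)) * (v x) ^ 2 + 4 * (-s + (N : ℝ))) / x
          + 4 * (v x) ^ 3 - 4 / v x := by
  have hp : IsLaguerreSeq p := by
    refine ⟨hp_neg, hp_zero, fun k x σ => ?_⟩
    rcases le_or_gt k 0 with hk | hk
    · rw [hp_neg (k - 1) (by omega), hp_neg (k - 2) (by omega)]
      rcases hk.lt_or_eq with hk | rfl
      · simp [hp_neg k hk]
      · simp
    · lift k to ℕ using hk.le
      exact_mod_cast hp_rec k (by omega) x σ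
  obtain ⟨n, rfl⟩ : ∃ n, N = n + 1 := ⟨N - 1, by omega⟩
  rw [Nat.add_sub_cancel] at hU2 hU4
  simp only [Nat.add_sub_cancel] at hv
  refine painleve_of_bilinear isOpen_Ioo (F₂ := fun x => umemuraU p (n - 1) x s)
    (G₂ := fun x => umemuraU p (n - 1) x (s - 1)) (fun x hx h => h0 (h ▸ hx)) hU1 hU3 hU2 hU4
    (fun x => hp.hasDerivAt_umemuraU _ x _) (fun x => hp.hasDerivAt_umemuraU _ x _)
    (fun x => hp.hasDerivAt_umemuraU _ x _) (fun x => hp.hasDerivAt_umemuraU _ x _)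
    (fun x => hp.hasDerivAt_umemuraU _ x _) (fun x => hp.bilinear_lower n x s)
    (fun x => hp.bilinear_upper n x s) ?_ ?_ (fun x => hp.bilinear_sizes n x s) hv
  · intro x
    cases n with
    | zero => simp [IsLaguerreSeq.umemuraU_zero]
    | succ n => exact hp.bilinear_lower n x s
  · intro x
    push_cast
    linear_combination hp.mul_wronskian_eq n x s
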